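/- Let A = ℝ[X, Y, Z]/(X² + Y² + Z² − 1) with x, y, z the images of X, Y, Z. The unimodular row (x, y, z) ∈ A³ is not completable: there is no matrix in GL_3(A) having (x, y, z) as its first row. -/

import Mathlib

open MvPolynomial

/-- The defining polynomial of the 2-sphere, `X² + Y² + Z² - 1`. -/
noncomputable def spherePoly : MvPolynomial (Fin 3) ℝ :=
  X 0 ^ 2 + X 1 ^ 2 + X 2 ^ 2 - 1

/-- The coordinate ring `ℝ[X,Y,Z]/(X² + Y² + Z² - 1)` of the real 2-sphere. -/
abbrev SphereRing : Type _ := MvPolynomial (Fin 3) ℝ ⧸ Ideal.span {spherePoly}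

/-- The canonical surjection onto the coordinate ring of the sphere. -/
noncomputable def sphereMk : MvPolynomial (Fin 3) ℝ →+* SphereRing :=
  Ideal.Quotient.mk (Ideal.span {spherePoly})

/-- A continuous logarithm of a constant is constant. -/
lemma log_const {h : ℝ → ℂ} (hc : Continuous h) (c : ℂ) (he : ∀ t, Complex.exp (h t) = c)
    (s t : ℝ) : h s = h t := by
  have := Complex.isCoveringMap_exp.eq_of_comp_eq hc (continuous_const (y := h t))
    (by ext u; simp [he]) t rfl
  exact congrFun this s

/-- Nowhere vanishing functions on the plane have continuous logarithms. -/
lemma exists_log (f : ℝ × ℝ → ℂ) (hf : Continuous f) (h0 : ∀ p, f p ≠ 0) :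
    ∃ g : ℝ × ℝ → ℂ, Continuous g ∧ ∀ p, Complex.exp (g p) = f p := by
  obtain ⟨F, ⟨_, hF⟩, _⟩ := Complex.isCoveringMapOn_exp.existsUnique_continuousMap_lifts
    (⟨f, hf⟩ : C(ℝ × ℝ, ℂ)) (a₀ := (0, 0)) (e₀ := Complex.log (f (0, 0)))
    (Complex.exp_log (h0 _)) (fun a => h0 a)
  exact ⟨F, F.continuous, fun p => congrFun hF p⟩

/-- Winding number argument: no nowhere vanishing homotopy between windings `-1` and `1`. -/
lemma no_homotopy (f : ℝ × ℝ → ℂ) (hf : Continuous f) (h0 : ∀ p, f p ≠ 0)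
    (hper : ∀ θ, f (θ, 2 * Real.pi) = f (θ, 0)) (a b : ℂ)
    (ha : ∀ φ : ℝ, f (0, φ) = a * Complex.exp (-(φ * Complex.I)))
    (hb : ∀ φ : ℝ, f (Real.pi, φ) = b * Complex.exp (φ * Complex.I)) : False := by
  obtain ⟨g, hg, hgf⟩ := exists_log f hf h0
  have h1 := log_const (h := fun φ : ℝ => g (0, φ) + φ * Complex.I) (by fun_prop) a
    (by intro t; rw [Complex.exp_add, hgf, ha, mul_assoc, ← Complex.exp_add]; simp)
    (2 * Real.pi) 0
  have h2 := log_const (h := fun φ : ℝ => g (Real.pi, φ) - φ * Complex.I) (by fun_prop) b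
    (by intro t; rw [sub_eq_add_neg, Complex.exp_add, hgf, hb, mul_assoc, ← Complex.exp_add]; simp)
    (2 * Real.pi) 0
  have h3 := log_const (h := fun θ : ℝ => g (θ, 2 * Real.pi) - g (θ, 0)) (by fun_prop) 1
    (by intro t; rw [Complex.exp_sub, hgf, hgf, hper, div_self (h0 _)]) 0 Real.pi

  have h4 : (Real.pi : ℂ) * Complex.I = 0 := by
    push_cast at h1 h2
    linear_combination (h1 - h2 - h3) / 4
  simp [Real.pi_ne_zero] at h4

/-- Evaluation of elements of the coordinate ring at a point of the sphere. -/
noncomputable def sphereEval (p : Fin 3 → ℝ) (hp : p 0 ^ 2 + p 1 ^ 2 + p 2 ^ 2 = 1) :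
    SphereRing →+* ℝ :=
  Ideal.Quotient.lift (Ideal.span {spherePoly}) (eval p) (by
    intro a ha
    obtain ⟨b, rfl⟩ := Ideal.mem_span_singleton.1 ha
    simp [spherePoly, hp])

lemma sphereEval_mk (p : Fin 3 → ℝ) (hp : p 0 ^ 2 + p 1 ^ 2 + p 2 ^ 2 = 1)
    (P : MvPolynomial (Fin 3) ℝ) : sphereEval p hp (sphereMk P) = eval p P := rfl

/-- Spherical coordinates. -/
noncomputable def sph (q : ℝ × ℝ) : Fin 3 → ℝ :=
  ![Real.sin q.1 * Real.cos q.2, Real.sin q.1 * Real.sin q.2, Real.cos q.1]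

lemma sph_mem (q : ℝ × ℝ) : sph q 0 ^ 2 + sph q 1 ^ 2 + sph q 2 ^ 2 = 1 := by
  simp only [sph, Matrix.cons_val]
  linear_combination (Real.sin q.1) ^ 2 * Real.sin_sq_add_cos_sq q.2 + Real.sin_sq_add_cos_sq q.1

lemma sph_continuous : Continuous sph := by
  refine continuous_pi fun i => ?_
  fin_cases i <;> simp [sph] <;> fun_prop

theorem stmt_12 :
    ¬ ∃ M : Matrix (Fin 3) (Fin 3) SphereRing,
        IsUnit M ∧ M 0 = ![sphereMk (X 0), sphereMk (X 1), sphereMk (X 2)] := by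
  rintro ⟨M, hM, hM0⟩
  have hsurj : ∀ i, ∃ P, sphereMk P = M 1 i := fun i => Ideal.Quotient.mk_surjective (M 1 i)
  choose P hP using hsurj
  have hPc : ∀ i, Continuous fun q : ℝ × ℝ => eval (sph q) (P i) := fun i =>
    (MvPolynomial.continuous_eval (P i)).comp sph_continuous
  let r : Fin 3 → ℝ × ℝ → ℝ := fun i q => eval (sph q) (P i)
  have hr : ∀ i, Continuous (r i) := hPc
  let A : ℝ × ℝ → ℝ := fun q => r 0 q * (Real.cos q.1 * Real.cos q.2) +
    r 1 q * (Real.cos q.1 * Real.sin q.2) - r 2 q * Real.sin q.1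
  let B : ℝ × ℝ → ℝ := fun q => - r 0 q * Real.sin q.2 + r 1 q * Real.cos q.2
  have hAc : Continuous A := by
    have := hr 0; have := hr 1; have := hr 2; fun_prop
  have hBc : Continuous B := by
    have := hr 0; have := hr 1; fun_prop
  have hne : ∀ q, A q = 0 → B q = 0 → False := by
    intro q hA hB
    have hu : IsUnit ((sphereEval (sph q) (sph_mem q)).mapMatrix M) := hM.map _
    have hd := ((Matrix.isUnit_iff_isUnit_det _).1 hu).ne_zero
    have s1 := Real.sin_sq_add_cos_sq q.1
    have s2 := Real.sin_sq_add_cos_sq q.2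
    have e1 : ∀ i, sphereEval (sph q) (sph_mem q) (M 1 i) = r i q := by
      intro i; rw [← hP, sphereEval_mk]
    have e0 : ∀ i, sphereEval (sph q) (sph_mem q) (M 0 i) = sph q i := by
      intro i; rw [hM0]; fin_cases i <;> simp [sphereEval_mk]
    apply hd
    simp only [A, B] at hA hB
    obtain ⟨k, hk⟩ : ∃ k, k = r 0 q * sph q 0 + r 1 q * sph q 1 + r 2 q * sph q 2 := ⟨_, rfl⟩
    simp only [sph, Matrix.cons_val] at hk
    have k0 : r 0 q = k * sph q 0 := by
      simp only [sph, Matrix.cons_val]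
      rw [hk]
      linear_combination (Real.cos q.1 * Real.cos q.2) * hA - Real.sin q.2 * hB
        - r 0 q * s2 - (r 0 q * Real.cos q.2 ^ 2 + r 1 q * Real.sin q.2 * Real.cos q.2) * s1
    have k1 : r 1 q = k * sph q 1 := by
      simp only [sph, Matrix.cons_val]
      rw [hk]
      linear_combination (Real.cos q.1 * Real.sin q.2) * hA + Real.cos q.2 * hB
        - r 1 q * s2 - (r 1 q * Real.sin q.2 ^ 2 + r 0 q * Real.sin q.2 * Real.cos q.2) * s1
    have k2 : r 2 q = k * sph q 2 := by
      simp only [sph, Matrix.cons_val]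
      rw [hk]
      linear_combination (- Real.sin q.1) * hA - r 2 q * s1
    rw [Matrix.det_fin_three]
    simp only [RingHom.mapMatrix_apply, Matrix.map_apply, e0, e1, k0, k1, k2]
    ring
  refine no_homotopy (fun q => (A q : ℂ) + B q * Complex.I) (by fun_prop) ?_ ?_
    (eval ![0, 0, 1] (P 0) + eval ![0, 0, 1] (P 1) * Complex.I)
    (- eval ![0, 0, -1] (P 0) + eval ![0, 0, -1] (P 1) * Complex.I) ?_ ?_
  · intro q hq
    have h1 := congrArg Complex.re hq
    have h2 := congrArg Complex.im hq
    simp at h1 h2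
    exact hne q h1 h2
  · intro θ
    simp [A, B, r, sph]
  · intro φ
    have : sph (0, φ) = ![0, 0, 1] := by simp [sph]
    rw [← neg_mul, ← Complex.ofReal_neg, Complex.exp_mul_I]
    simp only [A, B, r, this]
    simp
    linear_combination (((eval ![0, 0, 1] (P 1) : ℝ) : ℂ) * Complex.sin φ) * Complex.I_sq
  · intro φ
    have : sph (Real.pi, φ) = ![0, 0, -1] := by simp [sph]
    rw [Complex.exp_mul_I]
    simp only [A, B, r, this]
    simp
    linear_combination (-((eval ![0, 0, -1] (P 1) : ℝ) : ℂ) * Complex.sin φ) * Complex.I_sq
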